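/- Let R = ℚ(t₁, t₂, a)[Δ]/(Δ² − t₁t₂·Δ), the quotient of a polynomial ring in one variable Δ over the rational function field ℚ(t₁, t₂, a) by the relation Δ² = t₁t₂·Δ. Set s₁ = t₁ + t₂, s₂ = t₁² + t₁t₂ + t₂², and Ω = ((a − t₁)(a − t₂))^{-1} ∈ R (the element (a − t₁)(a − t₂) is invertible in R). Then (1 − Δ·Ω)·(a³ − s₂·a + s₁·Δ) = a³ − (s₂ + Δ)·a. -/

import Mathlib

noncomputable section

/-- The rational function field `ℚ(t₁, t₂, a)`. -/
abbrev K9 := FractionRing (MvPolynomial (Fin 3) ℚ)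

def t₁ : K9 := algebraMap (MvPolynomial (Fin 3) ℚ) K9 (MvPolynomial.X 0)
def t₂ : K9 := algebraMap (MvPolynomial (Fin 3) ℚ) K9 (MvPolynomial.X 1)
def aK : K9 := algebraMap (MvPolynomial (Fin 3) ℚ) K9 (MvPolynomial.X 2)

/-- `R = ℚ(t₁,t₂,a)[Δ]/(Δ² − t₁t₂Δ)`. -/
abbrev R9 := Polynomial K9 ⧸
  Ideal.span {(Polynomial.X : Polynomial K9) ^ 2 - Polynomial.C (t₁ * t₂) * Polynomial.X}

/-- The quotient map `ℚ(t₁,t₂,a)[Δ] → R`. -/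
def qm : Polynomial K9 →+* R9 :=
  Ideal.Quotient.mk _

/-- The class of `Δ` in `R`. -/
def Δ9 : R9 := qm Polynomial.X

/-- Constants of `R`, coming from `ℚ(t₁,t₂,a)`. -/
def ct (x : K9) : R9 := qm (Polynomial.C x)

/-- `s₁ = t₁ + t₂` and `s₂ = t₁² + t₁t₂ + t₂²` as elements of `R`. -/
def s₁ : R9 := ct (t₁ + t₂)
def s₂ : R9 := ct (t₁ ^ 2 + t₁ * t₂ + t₂ ^ 2)

/-- `a` as an element of `R`. -/
def aR : R9 := ct aK

theorem ct_sub_isUnit (i : Fin 3) (hi : (2 : Fin 3) ≠ i) :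
    IsUnit (aR - ct (algebraMap (MvPolynomial (Fin 3) ℚ) K9 (MvPolynomial.X i))) := by
  have h : aK - algebraMap (MvPolynomial (Fin 3) ℚ) K9 (MvPolynomial.X i) ≠ 0 := by
    intro h
    have h2 := IsFractionRing.injective (MvPolynomial (Fin 3) ℚ) K9 (sub_eq_zero.mp h)
    exact hi (MvPolynomial.X_injective h2)
  have h3 := (isUnit_iff_ne_zero.mpr h).map (qm.comp Polynomial.C)
  rw [map_sub] at h3
  exact h3

theorem delta_sq : Δ9 ^ 2 = ct t₁ * ct t₂ * Δ9 := by
  have h : qm ((Polynomial.X : Polynomial K9) ^ 2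
      - Polynomial.C (t₁ * t₂) * Polynomial.X) = 0 :=
    Ideal.Quotient.eq_zero_iff_mem.mpr (Ideal.subset_span rfl)
  simp only [map_sub, map_mul, map_pow] at h
  exact sub_eq_zero.mp h

/-- `(a − t₁)(a − t₂)` is invertible in `R`, and with
`Ω = ((a − t₁)(a − t₂))⁻¹` one has `(1 − ΔΩ)(a³ − s₂a + s₁Δ) = a³ − (s₂ + Δ)a`. -/
theorem antisymmetrization_identity :
    IsUnit ((aR - ct t₁) * (aR - ct t₂)) ∧
    (1 - Δ9 * Ring.inverse ((aR - ct t₁) * (aR - ct t₂))) *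
        (aR ^ 3 - s₂ * aR + s₁ * Δ9) =
      aR ^ 3 - (s₂ + Δ9) * aR := by
  have hu : IsUnit ((aR - ct t₁) * (aR - ct t₂)) :=
    (ct_sub_isUnit 0 (by decide)).mul (ct_sub_isUnit 1 (by decide))
  refine ⟨hu, ?_⟩
  have hinv := Ring.mul_inverse_cancel ((aR - ct t₁) * (aR - ct t₂)) hu
  have hs1 : s₁ = ct t₁ + ct t₂ := by simp [s₁, ct]
  have hs2 : s₂ = ct t₁ ^ 2 + ct t₁ * ct t₂ + ct t₂ ^ 2 := by simp [s₂, ct]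
  have hd := delta_sq
  rw [hs1, hs2]
  generalize Ring.inverse ((aR - ct t₁) * (aR - ct t₂)) = w at *
  generalize aR = a at *
  generalize ct t₁ = x at *
  generalize ct t₂ = y at *
  generalize Δ9 = d at *
  linear_combination (-(x + y) * w) * hd - (d * (a + x + y)) * hinv

end
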